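/- arXiv:1908.06679 — 3 statements merged into one kernel-verified Lean document; each statement's English description precedes it below -/
import Mathlib

section
/- For every admissible r ≥ 4, 0 ∈ J³_F(r); that is, there exist three STS(2r+1)'s on a common point set whose pairwise intersections all equal the same set of r triples forming the flower at a common point, and which share no other triple. -/
/-- A Steiner triple system of order `v`: a collection of 3-element subsets of a
`v`-point set such that every 2-element subset lies in exactly one triple. -/
def IsSTS (v : ℕ) (B : Finset (Finset (Fin v))) : Prop :=
  (∀ b ∈ B, b.card = 3) ∧
  ∀ p : Finset (Fin v), p.card = 2 → ∃! b, b ∈ B ∧ p ⊆ b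

/-- The flower at a point `x`: the set of all triples containing `x`. -/
def flowerAt {v : ℕ} (B : Finset (Finset (Fin v))) (x : Fin v) : Finset (Finset (Fin v)) :=
  B.filter fun b => x ∈ b

/-- `J3F r`: the set of all `k` for which there exist three `STS(2r+1)`'s on a common
point set such that each pair of them intersects in the same set of `k + r` triples,
`r` of which form the flower at a common point. -/
def J3F (r : ℕ) : Set ℕ :=
  {k | ∃ (B₁ B₂ B₃ : Finset (Finset (Fin (2 * r + 1)))) (x : Fin (2 * r + 1)),
    IsSTS (2 * r + 1) B₁ ∧ IsSTS (2 * r + 1) B₂ ∧ IsSTS (2 * r + 1) B₃ ∧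
    B₁ ∩ B₂ = B₁ ∩ B₃ ∧ B₁ ∩ B₂ = B₂ ∩ B₃ ∧
    (B₁ ∩ B₂).card = k + r ∧
    flowerAt B₁ x = flowerAt B₂ x ∧ flowerAt B₁ x = flowerAt B₃ x ∧
    (flowerAt B₁ x).card = r}

/-- `J3 v`: the set of all `k` for which there exist three `STS(v)`'s on a common point
set pairwise intersecting in the same set of `k` triples. -/
def J3 (v : ℕ) : Set ℕ :=
  {k | ∃ (B₁ B₂ B₃ : Finset (Finset (Fin v))),
    IsSTS v B₁ ∧ IsSTS v B₂ ∧ IsSTS v B₃ ∧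
    B₁ ∩ B₂ = B₁ ∩ B₃ ∧ B₁ ∩ B₂ = B₂ ∩ B₃ ∧ (B₁ ∩ B₂).card = k}

/-- `JF r`: the set of all `k` for which there exist two `STS(2r+1)`'s on a common
point set having exactly `k + r` triples in common, `r` of them forming a common flower. -/
def JF (r : ℕ) : Set ℕ :=
  {k | ∃ (B₁ B₂ : Finset (Finset (Fin (2 * r + 1)))) (x : Fin (2 * r + 1)),
    IsSTS (2 * r + 1) B₁ ∧ IsSTS (2 * r + 1) B₂ ∧
    (B₁ ∩ B₂).card = k + r ∧
    flowerAt B₁ x = flowerAt B₂ x ∧ (flowerAt B₁ x).card = r}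

/-- `S3 m`: the nonnegative integers at most `m`, with the exception of
`m-1, m-2, m-3, m-4, m-5, m-7`. -/
def S3 (m : ℕ) : Set ℕ :=
  {k | k ≤ m ∧ k + 1 ≠ m ∧ k + 2 ≠ m ∧ k + 3 ≠ m ∧ k + 4 ≠ m ∧ k + 5 ≠ m ∧ k + 7 ≠ m}

/-- `I3F r = S3 (2r(r-1)/3)`. -/
def I3F (r : ℕ) : Set ℕ := S3 (2 * r * (r - 1) / 3)

/-- A Latin square of order `n` as a function: each row and each column is injective
(hence a permutation of the `n` symbols). -/
def IsLatin (n : ℕ) (L : Fin n → Fin n → Fin n) : Prop :=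
  (∀ i, Function.Injective (L i)) ∧ (∀ j, Function.Injective fun i => L i j)

/-- The cells where three squares all have identical entries. -/
def agreeCells (n : ℕ) (L₁ L₂ L₃ : Fin n → Fin n → Fin n) : Finset (Fin n × Fin n) :=
  Finset.univ.filter fun p => L₁ p.1 p.2 = L₂ p.1 p.2 ∧ L₂ p.1 p.2 = L₃ p.1 p.2

/-- `J3L n` (written `J'³(n)`): the set of `k` for which there exist three Latin squares
of order `n` with exactly `k` cells where all three have identical entries and all other
cells containing pairwise distinct entries in the three squares. -/
def J3L (n : ℕ) : Set ℕ :=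
  {k | ∃ L₁ L₂ L₃ : Fin n → Fin n → Fin n,
    IsLatin n L₁ ∧ IsLatin n L₂ ∧ IsLatin n L₃ ∧
    (agreeCells n L₁ L₂ L₃).card = k ∧
    ∀ p : Fin n × Fin n, p ∉ agreeCells n L₁ L₂ L₃ →
      L₁ p.1 p.2 ≠ L₂ p.1 p.2 ∧ L₁ p.1 p.2 ≠ L₃ p.1 p.2 ∧ L₂ p.1 p.2 ≠ L₃ p.1 p.2}

/-- `J3LD n` (written `J''³(n)`): as `J3L n`, but additionally the three Latin squares
share the same constant value on the secondary diagonal (cells `(i, n-1-i)`). -/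
def J3LD (n : ℕ) : Set ℕ :=
  {k | ∃ L₁ L₂ L₃ : Fin n → Fin n → Fin n,
    IsLatin n L₁ ∧ IsLatin n L₂ ∧ IsLatin n L₃ ∧
    (∃ c, ∀ i : Fin n, L₁ i i.rev = c ∧ L₂ i i.rev = c ∧ L₃ i i.rev = c) ∧
    (agreeCells n L₁ L₂ L₃).card = k ∧
    ∀ p : Fin n × Fin n, p ∉ agreeCells n L₁ L₂ L₃ →
      L₁ p.1 p.2 ≠ L₂ p.1 p.2 ∧ L₁ p.1 p.2 ≠ L₃ p.1 p.2 ∧ L₂ p.1 p.2 ≠ L₃ p.1 p.2}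

/-- A pairwise balanced design `B(K, 1, v)`: blocks have sizes in `K` and every
2-element subset of the `v`-point set lies in exactly one block. -/
def IsPBD (v : ℕ) (K : Set ℕ) (A : Finset (Finset (Fin v))) : Prop :=
  (∀ b ∈ A, b.card ∈ K) ∧
  ∀ p : Finset (Fin v), p.card = 2 → ∃! b, b ∈ A ∧ p ⊆ b
/-- A Steiner loop: a commutative loop with identity `one` satisfying `x (x y) = y`. -/
structure IsSteinerLoop {L : Type} (one : L) (f : L → L → L) : Prop where
  comm : ∀ x y, f x y = f y x
  cancel : ∀ x y, f x (f x y) = y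
  one_mul : ∀ x, f one x = x

/-- Three Steiner loops with a common identity whose associated Steiner triple systems share
exactly the flower at `e`. -/
structure IsLoopTriple {L : Type} (one e : L) (f : Fin 3 → L → L → L) : Prop where
  loop : ∀ i, IsSteinerLoop one (f i)
  ne : e ≠ one
  flower : ∀ i j x, f i e x = f j e x
  disj : ∀ i j x y, i ≠ j → f i x y = f j x y →
    (x = one ∨ x = e) ∨ (y = one ∨ y = e) ∨ (f i x y = one ∨ f i x y = e)

/-- Existence of three Steiner loops as in `IsLoopTriple` on `2 * r + 2` elements. -/
def HasLoopTriple (r : ℕ) : Prop :=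
  ∃ (L : Type) (_ : Fintype L) (one e : L) (f : Fin 3 → L → L → L),
    Fintype.card L = 2 * r + 2 ∧ IsLoopTriple one e f

/-- The operation of a group divisible design with blocks of size three on `M × K`, whose groups
are the fibres of the first projection: it completes two points of distinct groups to a block. -/
def IsGDDOp {M K : Type} (g : M × K → M × K → M × K) : Prop :=
  ∀ p q, p.1 ≠ q.1 → (g p q).1 ≠ p.1 ∧ g p q = g q p ∧ g p (g p q) = q

namespace IsSteinerLoop

variable {L : Type} {one : L} {f : L → L → L}

theorem mul_one (h : IsSteinerLoop one f) (x : L) : f x one = x := by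
  rw [h.comm, h.one_mul]

theorem mul_self (h : IsSteinerLoop one f) (x : L) : f x x = one := by
  simpa [h.mul_one] using h.cancel x one

theorem cancel_right (h : IsSteinerLoop one f) (x y : L) : f (f x y) y = x := by
  rw [h.comm, h.comm x y, h.cancel]

theorem left_inj (h : IsSteinerLoop one f) {x y z : L} : f x y = f x z ↔ y = z :=
  ⟨fun e => by rw [← h.cancel x y, e, h.cancel], fun e => e ▸ rfl⟩

theorem right_inj (h : IsSteinerLoop one f) {x y z : L} : f y x = f z x ↔ y = z := by
  rw [h.comm y, h.comm z, h.left_inj]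

theorem mul_eq_one (h : IsSteinerLoop one f) {x y : L} : f x y = one ↔ y = x := by
  rw [← h.mul_self x, h.left_inj]

theorem mul_eq_left (h : IsSteinerLoop one f) {x y : L} : f x y = x ↔ y = one := by
  nth_rewrite 2 [← h.mul_one x]
  rw [h.left_inj]

end IsSteinerLoop

/-- A fixed-point-free involution on `2 * m` points is the flip of the second coordinate on
`Fin m × Bool`, up to relabelling. -/
theorem exists_equiv_flip {Y : Type} [Fintype Y] (s : Y → Y) (hs : ∀ x, s (s x) = x)
    (hne : ∀ x, s x ≠ x) {m : ℕ} (hc : Fintype.card Y = 2 * m) :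
    ∃ φ : Fin m × Bool ≃ Y, ∀ k b, φ (k, !b) = s (φ (k, b)) := by
  classical
  let _ : LinearOrder Y := LinearOrder.lift' (Fintype.equivFin Y) (Fintype.equivFin Y).injective
  have hgt : ∀ y, ¬ y < s y → s y < s (s y) := fun y hy => by
    rw [hs]; exact lt_of_le_of_ne (not_lt.1 hy) (hne y)
  let ψ : {x : Y // x < s x} × Bool ≃ Y :=
    { toFun := fun p => if p.2 then s p.1 else p.1
      invFun := fun y => if h : y < s y then (⟨y, h⟩, false) else (⟨s y, hgt y h⟩, true)
      left_inv := by
        rintro ⟨⟨x, hx⟩, b⟩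
        cases b
        · simp [hx]
        · simp [hs, hx.le.not_gt]
      right_inv := fun y => by
        by_cases h : y < s y <;> simp [h, hs] }
  have hR : Fintype.card {x : Y // x < s x} = m := by
    have := Fintype.card_congr ψ
    rw [Fintype.card_prod, Fintype.card_bool] at this
    omega
  refine ⟨((Fintype.equivFinOfCardEq hR).symm.prodCongr (Equiv.refl Bool)).trans ψ, ?_⟩
  intro k b
  cases b <;> simp [ψ, hs]

theorem card_ne_ne {L : Type} [Fintype L] [DecidableEq L] {a b : L} (hab : a ≠ b) :
    Fintype.card {x : L // ¬ (x = a ∨ x = b)} = Fintype.card L - 2 := by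
  have h : Fintype.card {x : L // x = a ∨ x = b} = 2 := by
    rw [Fintype.card_subtype, ← Finset.card_pair hab]
    congr 1
    ext; simp
  rw [Fintype.card_subtype_compl, h]

theorem exists_isGDDOp {m : ℕ} {L : Type} [Fintype L] {one e : L} {f : L → L → L}
    (hf : IsSteinerLoop one f) (he : e ≠ one) (hc : Fintype.card L = 2 * m + 2) :
    ∃ g : Fin m × Bool → Fin m × Bool → Fin m × Bool, IsGDDOp g := by
  classical
  have hfe : ∀ x, f e x = one ↔ x = e := fun x => hf.mul_eq_one
  have hfe' : ∀ x, f e x = e ↔ x = one := fun x => hf.mul_eq_left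
  obtain ⟨φ, hφ⟩ := exists_equiv_flip (Y := {x : L // ¬ (x = one ∨ x = e)}) (m := m)
    (fun x => ⟨f e x, by rw [hfe, hfe', or_comm]; exact x.2⟩)
    (fun x => Subtype.ext (hf.cancel _ _))
    (fun x hx => by
      have := congrArg Subtype.val hx
      simp only [hf.comm e, hf.mul_eq_left] at this
      exact he this)
    (by rw [card_ne_ne he.symm, hc]; rfl)
  have hflip : ∀ k b, (φ (k, !b) : L) = f e (φ (k, b)) := fun k b =>
    congrArg Subtype.val (hφ k b)
  have hfib : ∀ p q : Fin m × Bool, p.1 ≠ q.1 ↔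
      f (φ p) (φ q) ≠ one ∧ f (φ p) (φ q) ≠ e := by
    rintro ⟨k, b⟩ ⟨l, c⟩
    rw [ne_eq, ne_eq, ne_eq, hf.mul_eq_one, ← not_or, not_iff_not]
    have h2 : f (φ (k, b)) (φ (l, c)) = e ↔ (φ (l, c) : L) = φ (k, !b) := by
      rw [hflip, hf.comm e, ← hf.left_inj (x := φ (k, b)), hf.cancel]
    rw [h2, ← Subtype.ext_iff, ← Subtype.ext_iff, φ.injective.eq_iff, φ.injective.eq_iff]
    cases b <;> cases c <;> simp [eq_comm]
  have hex : ∀ p q : Fin m × Bool, ∃ z, p.1 ≠ q.1 → (φ z : L) = f (φ p) (φ q) := by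
    intro p q
    by_cases h : p.1 = q.1
    · exact ⟨p, fun h' => (h' h).elim⟩
    · have := (hfib p q).1 h
      exact ⟨φ.symm ⟨_, not_or.2 this⟩, fun _ => by simp⟩
  choose g hg using hex
  have hinj : ∀ p q, (φ p : L) = φ q → p = q := fun p q h => φ.injective (Subtype.ext h)
  refine ⟨g, fun p q h => ?_⟩
  have h1 : p.1 ≠ (g p q).1 := by
    rw [hfib, hg p q h, hf.cancel]
    exact not_or.1 (φ q).2
  refine ⟨h1.symm, hinj _ _ ?_, hinj _ _ ?_⟩
  · rw [hg p q h, hg q p h.symm, hf.comm]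
  · rw [hg _ _ h1, hg p q h, hf.cancel]

theorem exists_disjoint_isGDDOp {m : ℕ} {g : Fin m × Bool → Fin m × Bool → Fin m × Bool}
    (hg : IsGDDOp g) {w : ℕ} (hw : 3 ≤ w) :
    ∃ F : Fin 3 → Fin m × (Bool × ZMod w) → Fin m × (Bool × ZMod w) → Fin m × (Bool × ZMod w),
      (∀ i, IsGDDOp (F i)) ∧ ∀ i j p q, i ≠ j → F i p q ≠ F j p q := by
  refine ⟨fun i p q => ((g (p.1, p.2.1) (q.1, q.2.1)).1, (g (p.1, p.2.1) (q.1, q.2.1)).2,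
    (i.val : ZMod w) - p.2.2 - q.2.2), fun i p q h => ?_, fun i j p q hij heq => hij ?_⟩
  · obtain ⟨h1, h2, h3⟩ := hg (p.1, p.2.1) (q.1, q.2.1) h
    refine ⟨h1, ?_, ?_⟩
    · simp only [h2, Prod.mk.injEq, true_and]
      ring
    · simp only [Prod.mk.eta, h3]
      refine Prod.ext rfl (Prod.ext rfl ?_)
      simp only
      ring
  · have h := congrArg (fun z => z.2.2) heq
    simp only [sub_left_inj] at h
    rw [ZMod.natCast_eq_natCast_iff', Nat.mod_eq_of_lt (by omega),
      Nat.mod_eq_of_lt (by omega)] at h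
    exact Fin.ext h

theorem IsLoopTriple.transport {L L' : Type} {one e : L} {f : Fin 3 → L → L → L}
    (h : IsLoopTriple one e f) (E : L ≃ L') :
    IsLoopTriple (E one) (E e) fun i x y => E (f i (E.symm x) (E.symm y)) where
  loop i :=
    { comm := fun x y => by rw [(h.loop i).comm]
      cancel := fun x y => by simp [(h.loop i).cancel]
      one_mul := fun x => by simp [(h.loop i).one_mul] }
  ne := by simpa using h.ne
  flower i j x := by simpa using h.flower i j _
  disj i j x y hij heq := by
    simpa [Equiv.symm_apply_eq] using h.disj i j _ _ hij (E.injective heq)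

section Fill

variable {S K M : Type}

open Classical in
/-- Fill the groups of a group divisible design on `M × K` with copies of a loop on `S ⊕ K`
that overlap in `S`. -/
noncomputable def fillOp (m₀ : M) (f : S ⊕ K → S ⊕ K → S ⊕ K) (F : M × K → M × K → M × K) :
    S ⊕ M × K → S ⊕ M × K → S ⊕ M × K
  | .inl s, .inl t => Sum.map id (Prod.mk m₀) (f (.inl s) (.inl t))
  | .inl s, .inr (m, k) => Sum.map id (Prod.mk m) (f (.inl s) (.inr k))
  | .inr (m, k), .inl s => Sum.map id (Prod.mk m) (f (.inr k) (.inl s))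
  | .inr p, .inr q =>
    if p.1 = q.1 then Sum.map id (Prod.mk p.1) (f (.inr p.2) (.inr q.2)) else .inr (F p q)

theorem fillOp_map {m₀ : M} {f : S ⊕ K → S ⊕ K → S ⊕ K} {F : M × K → M × K → M × K}
    (hS : ∀ s t, ∃ u, f (.inl s) (.inl t) = .inl u) (m : M) (x y : S ⊕ K) :
    fillOp m₀ f F (Sum.map id (Prod.mk m) x) (Sum.map id (Prod.mk m) y) =
      Sum.map id (Prod.mk m) (f x y) := by
  rcases x with s | k <;> rcases y with t | l
  · obtain ⟨u, hu⟩ := hS s t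
    simp [fillOp, hu]
  all_goals simp [fillOp]

theorem fillOp_of_ne {m₀ : M} {f : S ⊕ K → S ⊕ K → S ⊕ K} {F : M × K → M × K → M × K}
    {p q : M × K} (h : p.1 ≠ q.1) : fillOp m₀ f F (.inr p) (.inr q) = .inr (F p q) := by
  simp [fillOp, h]

theorem exists_map_or_ne (m₀ : M) (x y : S ⊕ M × K) :
    (∃ m x' y', x = Sum.map id (Prod.mk m) x' ∧ y = Sum.map id (Prod.mk m) y') ∨
      ∃ p q : M × K, p.1 ≠ q.1 ∧ x = .inr p ∧ y = .inr q := by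
  rcases x with s | ⟨m, k⟩ <;> rcases y with t | ⟨n, l⟩
  · exact .inl ⟨m₀, .inl s, .inl t, rfl, rfl⟩
  · exact .inl ⟨n, .inl s, .inr l, rfl, rfl⟩
  · exact .inl ⟨m, .inr k, .inl t, rfl, rfl⟩
  · by_cases h : m = n
    · subst h
      exact .inl ⟨m, .inr k, .inr l, rfl, rfl⟩
    · exact .inr ⟨_, _, h, rfl, rfl⟩

theorem map_prodMk_injective (m : M) :
    Function.Injective (Sum.map id (Prod.mk m) : S ⊕ K → S ⊕ M × K) :=
  Function.Injective.sumMap Function.injective_id (Prod.mk_right_injective m)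

theorem isLoopTriple_fillOp (m₀ : M) {one e : S} {f : Fin 3 → S ⊕ K → S ⊕ K → S ⊕ K}
    {F : Fin 3 → M × K → M × K → M × K} (h : IsLoopTriple (.inl one) (.inl e) f)
    (hS : ∀ i s t, ∃ u, f i (.inl s) (.inl t) = .inl u)
    (hF : ∀ i, IsGDDOp (F i)) (hd : ∀ i j p q, i ≠ j → F i p q ≠ F j p q) :
    IsLoopTriple (.inl one) (.inl e) fun i => fillOp m₀ (f i) (F i) := by
  have hinl : ∀ (m : M) (s : S), (Sum.inl s : S ⊕ M × K) = Sum.map id (Prod.mk m) (.inl s) :=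
    fun _ _ => rfl
  refine ⟨fun i => ⟨fun x y => ?_, fun x y => ?_, fun x => ?_⟩, ?_, fun i j x => ?_,
    fun i j x y hij heq => ?_⟩
  · rcases exists_map_or_ne m₀ x y with ⟨m, x, y, rfl, rfl⟩ | ⟨p, q, hpq, rfl, rfl⟩
    · rw [fillOp_map (hS i), fillOp_map (hS i), (h.loop i).comm]
    · rw [fillOp_of_ne hpq, fillOp_of_ne hpq.symm, (hF i p q hpq).2.1]
  · rcases exists_map_or_ne m₀ x y with ⟨m, x, y, rfl, rfl⟩ | ⟨p, q, hpq, rfl, rfl⟩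
    · rw [fillOp_map (hS i), fillOp_map (hS i), (h.loop i).cancel]
    · rw [fillOp_of_ne hpq, fillOp_of_ne (hF i p q hpq).1.symm, (hF i p q hpq).2.2]
  · rcases exists_map_or_ne m₀ x x with ⟨m, x, y, rfl, -⟩ | ⟨p, q, hpq, h1, h2⟩
    · rw [hinl m, fillOp_map (hS i), (h.loop i).one_mul]
    · exact (hpq (by simpa using congrArg (Sum.elim (fun _ => m₀) Prod.fst) (h1.symm.trans h2))).elim
  · simpa using h.ne
  · rcases exists_map_or_ne m₀ x x with ⟨m, x, y, rfl, -⟩ | ⟨p, q, hpq, h1, h2⟩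
    · simp only [hinl m]
      rw [fillOp_map (hS i), fillOp_map (hS j), h.flower i j]
    · exact (hpq (by simpa using congrArg (Sum.elim (fun _ => m₀) Prod.fst) (h1.symm.trans h2))).elim
  · rcases exists_map_or_ne m₀ x y with ⟨m, x, y, rfl, rfl⟩ | ⟨p, q, hpq, rfl, rfl⟩
    · simp only [hinl m] at heq ⊢
      rw [fillOp_map (hS i), fillOp_map (hS j)] at heq
      rw [fillOp_map (hS i)]
      simpa only [(map_prodMk_injective m).eq_iff] using
        h.disj i j x y hij (map_prodMk_injective m heq)
    · simp only [fillOp_of_ne hpq] at heq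
      exact (hd i j p q hij (Sum.inr_injective heq)).elim

end Fill

/-- Inflate a group divisible design of type `2 ^ m` by weight `w` and fill its groups with a loop
triple, the copies overlapping in a subloop `P` of size `c`. -/
theorem hasLoopTriple_inflate {m w c r : ℕ} (hm : 0 < m) (hw : 3 ≤ w)
    {g : Fin m × Bool → Fin m × Bool → Fin m × Bool} (hg : IsGDDOp g)
    {L : Type} [Fintype L] {one e : L} {f : Fin 3 → L → L → L} (h : IsLoopTriple one e f)
    (P : L → Prop) (h1 : P one) (he : P e) (hP : ∀ i x y, P x → P y → P (f i x y))
    (hcP : Nat.card {x // P x} = c) (hcL : Fintype.card L = c + 2 * w)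
    (hr : 2 * r + 2 = c + m * (2 * w)) : HasLoopTriple r := by
  classical
  have : NeZero w := ⟨by omega⟩
  rw [Nat.card_eq_fintype_card] at hcP
  have hcK : Fintype.card {x // ¬ P x} = Fintype.card (Bool × ZMod w) := by
    rw [Fintype.card_subtype_compl, hcP, hcL, Fintype.card_prod, Fintype.card_bool, ZMod.card]
    omega
  let E : L ≃ {x // P x} ⊕ (Bool × ZMod w) :=
    (Equiv.sumCompl P).symm.trans ((Equiv.refl _).sumCongr (Fintype.equivOfCardEq hcK))
  have hE : ∀ x (hx : P x), E x = .inl ⟨x, hx⟩ := fun x hx => by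
    simp [E, Equiv.sumCompl_symm_apply_of_pos, hx]
  have hE' : ∀ s, E.symm (.inl s) = s.1 := fun s => by
    rw [Equiv.symm_apply_eq, hE _ s.2]
  obtain ⟨F, hF, hd⟩ := exists_disjoint_isGDDOp hg hw
  have ht := h.transport E
  rw [hE _ h1, hE _ he] at ht
  refine ⟨_, inferInstance, _, _, _, ?_, isLoopTriple_fillOp ⟨0, hm⟩ ht ?_ hF hd⟩
  · rw [Fintype.card_sum, hcP, Fintype.card_prod, Fintype.card_prod, Fintype.card_bool,
      ZMod.card, Fintype.card_fin, hr]
  · intro i s t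
    rw [hE', hE', hE _ (hP i _ _ s.2 t.2)]
    exact ⟨_, rfl⟩

theorem HasLoopTriple.mul {m r : ℕ} (hm : 0 < m) (hr : 3 ≤ r)
    {g : Fin m × Bool → Fin m × Bool → Fin m × Bool} (hg : IsGDDOp g) (h : HasLoopTriple r) :
    HasLoopTriple (m * r) := by
  classical
  obtain ⟨L, _, one, e, f, hc, h⟩ := h
  refine hasLoopTriple_inflate hm hr hg h (fun x => x = one ∨ x = e) (.inl rfl) (.inr rfl)
    ?_ (c := 2) ?_ (by omega) (by ring)
  · rintro i x y (rfl | rfl) (rfl | rfl) <;>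
      simp [(h.loop i).one_mul, (h.loop i).mul_one, (h.loop i).mul_self]
  · rw [Nat.card_eq_fintype_card, Fintype.card_subtype, ← Finset.card_pair h.ne.symm]
    congr 1
    ext; simp

theorem HasLoopTriple.mul_add_one {m r : ℕ} (hm : 0 < m) (hr : 3 ≤ r)
    {g : Fin m × Bool → Fin m × Bool → Fin m × Bool} (hg : IsGDDOp g)
    (h : HasLoopTriple (r + 1)) : HasLoopTriple (m * r + 1) := by
  classical
  obtain ⟨L, _, one, e, f, hc, h⟩ := h
  obtain ⟨a, ha⟩ : ∃ a : L, a ∉ ({one, e} : Finset L) := by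
    by_contra! hall
    have := Finset.card_le_card (s := Finset.univ) (t := {one, e}) (fun x _ => hall x)
    rw [Finset.card_univ, Finset.card_pair h.ne.symm] at this
    omega
  simp only [Finset.mem_insert, Finset.mem_singleton, not_or] at ha
  obtain ⟨b, hb⟩ : ∃ b, ∀ i, f i e a = b := ⟨f 0 e a, fun i => h.flower i 0 a⟩
  have hb1 : b ≠ one := fun h' => ha.2 ((h.loop 0).mul_eq_one.1 ((hb 0).trans h'))
  have hbe : b ≠ e := fun h' => ha.1 ((h.loop 0).mul_eq_left.1 ((hb 0).trans h'))
  have hba : b ≠ a := fun h' => h.ne ((h.loop 0).mul_eq_left.1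
    (((h.loop 0).comm a e).trans ((hb 0).trans h')))
  have hae : ∀ i, f i a e = b := fun i => by rw [(h.loop i).comm, hb]
  have heb : ∀ i, f i e b = a := fun i => by rw [← hb i, (h.loop i).cancel]
  have hbe' : ∀ i, f i b e = a := fun i => by rw [(h.loop i).comm, heb]
  have hab : ∀ i, f i a b = e := fun i => by rw [← hae i, (h.loop i).cancel]
  have hba' : ∀ i, f i b a = e := fun i => by rw [(h.loop i).comm, hab]
  refine hasLoopTriple_inflate hm hr hg h (fun x => x ∈ ({one, e, a, b} : Finset L)) (by simp)
    (by simp) ?_ (c := 4) ?_ (by omega) (by ring)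
  · intro i x y hx hy
    simp only [Finset.mem_insert, Finset.mem_singleton] at hx hy ⊢
    rcases hx with rfl | rfl | rfl | rfl <;> rcases hy with rfl | rfl | rfl | rfl <;>
      simp [(h.loop i).one_mul, (h.loop i).mul_one, (h.loop i).mul_self, *]
  · rw [Nat.card_eq_fintype_card, Fintype.card_coe]
    rw [Finset.card_insert_of_notMem, Finset.card_insert_of_notMem,
      Finset.card_insert_of_notMem, Finset.card_singleton]
    · simpa using hba.symm
    · simpa using ⟨Ne.symm ha.2, hbe.symm⟩
    · simpa using ⟨h.ne.symm, Ne.symm ha.1, hb1.symm⟩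

theorem HasLoopTriple.exists_isGDDOp {m : ℕ} (h : HasLoopTriple m) :
    ∃ g : Fin m × Bool → Fin m × Bool → Fin m × Bool, IsGDDOp g := by
  obtain ⟨L, _, one, e, f, hc, h⟩ := h
  exact _root_.exists_isGDDOp (h.loop 0) h.ne hc

theorem exists_disjoint_perms {L : Type} [Fintype L] [DecidableEq L] {a b : L} (hab : a ≠ b)
    (hc : 5 ≤ Fintype.card L) :
    ∃ π : Fin 3 → Equiv.Perm L, (∀ i x, x = a ∨ x = b → π i x = x) ∧
      ∀ i j x, i ≠ j → π i x = π j x → x = a ∨ x = b := by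
  obtain ⟨n, hn⟩ : ∃ n, Fintype.card L = n + 2 := ⟨Fintype.card L - 2, by omega⟩
  have : NeZero n := ⟨by omega⟩
  have hY : Fintype.card {x : L // ¬ (x = a ∨ x = b)} = Fintype.card (ZMod n) := by
    rw [card_ne_ne hab, hn, ZMod.card]; rfl
  let φ := Fintype.equivOfCardEq hY
  let τ : Fin 3 → Equiv.Perm {x : L // ¬ (x = a ∨ x = b)} := fun i =>
    (φ.trans (Equiv.addRight (i.val : ZMod n))).trans φ.symm
  refine ⟨fun i => Equiv.Perm.ofSubtype (τ i), fun i x hx => ?_, fun i j x hij h => ?_⟩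
  · exact Equiv.Perm.ofSubtype_apply_of_not_mem (τ i) (not_not.2 hx)
  · by_contra hx
    rw [Equiv.Perm.ofSubtype_apply_of_mem (τ i) hx,
      Equiv.Perm.ofSubtype_apply_of_mem (τ j) hx] at h
    have h := Subtype.ext h
    simp only [τ, Equiv.trans_apply, φ.symm.injective.eq_iff, Equiv.coe_addRight,
      add_right_inj] at h
    rw [ZMod.natCast_eq_natCast_iff', Nat.mod_eq_of_lt (by omega),
      Nat.mod_eq_of_lt (by omega)] at h
    exact hij (Fin.ext h)

/-- The doubling of `f` in which the one-factorization given by `f₀` is relabelled by `π`. -/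
def doubleOp {L : Type} (f f₀ : L → L → L) (π : Equiv.Perm L) : L × Bool → L × Bool → L × Bool
  | (x, false), (y, false) => (f x y, false)
  | (x, false), (y, true) => (f₀ (π x) y, true)
  | (x, true), (y, false) => (f₀ (π y) x, true)
  | (x, true), (y, true) => (π.symm (f₀ x y), false)

theorem HasLoopTriple.double {r : ℕ} (hr : 2 ≤ r) (h : HasLoopTriple r) :
    HasLoopTriple (2 * r + 1) := by
  classical
  obtain ⟨L, _, one, e, f, hc, h⟩ := h
  obtain ⟨π, hfix, hd⟩ := exists_disjoint_perms h.ne.symm (by omega)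
  have h0 := h.loop 0
  have h1 : ∀ i, π i one = one := fun i => hfix i _ (.inl rfl)
  have he : ∀ i, π i e = e := fun i => hfix i _ (.inr rfl)
  refine ⟨L × Bool, inferInstance, (one, false), (e, false),
    fun i => doubleOp (f i) (f 0) (π i), ?_, fun i => ⟨?_, ?_, ?_⟩, ?_, ?_, ?_⟩
  · rw [Fintype.card_prod, hc, Fintype.card_bool]; ring
  · rintro ⟨x, _ | _⟩ ⟨y, _ | _⟩ <;> simp [doubleOp, (h.loop i).comm x y, h0.comm x y]
  · rintro ⟨x, _ | _⟩ ⟨y, _ | _⟩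
    · simp [doubleOp, (h.loop i).cancel]
    · simp [doubleOp, h0.cancel]
    · simp [doubleOp, h0.comm x, h0.cancel_right]
    · simp [doubleOp, h0.cancel_right, h0.comm x y]
  · rintro ⟨x, _ | _⟩ <;> simp [doubleOp, (h.loop i).one_mul, h0.one_mul, h1]
  · simpa using h.ne
  · rintro i j ⟨x, _ | _⟩ <;> simp [doubleOp, he, h.flower i j]
  · rintro i j ⟨x, _ | _⟩ ⟨y, _ | _⟩ hij heq
    · simpa [doubleOp] using h.disj i j x y hij (by simpa [doubleOp] using heq)
    · simp only [doubleOp, Prod.mk.injEq, and_true, h0.right_inj] at heq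
      exact Or.inl (by simpa using hd i j x hij heq)
    · simp only [doubleOp, Prod.mk.injEq, and_true, h0.right_inj] at heq
      exact Or.inr (Or.inl (by simpa using hd i j y hij heq))
    · simp only [doubleOp, Prod.mk.injEq, and_true] at heq
      have := hd i j ((π i).symm (f 0 x y)) hij (by
        rw [Equiv.apply_symm_apply, heq, Equiv.apply_symm_apply])
      exact Or.inr (Or.inr (by simpa [doubleOp] using this))

/-- The binary operation on `Fin n` whose value table is the sequence of hexadecimal digits
of `t`. -/
def tableOp (n : ℕ) [NeZero n] (t : ℕ) (x y : Fin n) : Fin n :=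
  Fin.ofNat n (t / 16 ^ (n * x + y) % 16)

theorem hasLoopTriple_four : HasLoopTriple 4 := by
  refine ⟨Fin 10, inferInstance, 0, 1, fun i => tableOp 10 (![
    11513749798669751574901635227442340532826024240732497218129192720529417460097385512475421838995634019715657791559709200,
    12732911696632376535135965299039710804439760525696727381555362766333380718984507388800420910543843619654753420957725200,
    13335620622134440466060618019032196027551924866852283358435941577783568220317438904744843711246405307054709137594397200] i), rfl, fun i => ⟨?_, ?_, ?_⟩, by decide, ?_, ?_⟩
  · revert i; decide +kernel
  · revert i; decide +kernel
  · revert i; decide +kernel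
  · decide +kernel
  · decide +kernel

theorem hasLoopTriple_six : HasLoopTriple 6 := by
  refine ⟨Fin 14, inferInstance, 0, 1, fun i => tableOp 14 (![
    581052499712900918242383793298986192549745177898898868557135143851501208888547207403806062166532169457347590225438845040141328419836925894730964463811869095913404788954253168673719408747981337787477051936201838737064450273726315115024,
    549914613700194638360857603885150899700921865947279161855771603553151865576805054340896096922697364833811644184599690943914040739516044723864036381788673844624320739706810301401538776325784345330918505439505151458414480420550936375824,
    532735906976990539518443600229262674586454713484769805419450975927577047149344944726260601520305254257622913640517200513205731154983660934198256982261289318702581542104286711281651871835849836889477188265465667528575237847524352209424] i), rfl, fun i => ⟨?_, ?_, ?_⟩, by decide, ?_, ?_⟩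
  · revert i; decide +kernel
  · revert i; decide +kernel
  · revert i; decide +kernel
  · decide +kernel
  · decide +kernel

theorem hasLoopTriple_seven : HasLoopTriple 7 := by
  refine ⟨Fin 16, inferInstance, 0, 1, fun i => tableOp 16 (![
    989096041407561553375555927479276926321662589460625572625085033142717171920440184734795869953186844435928023787224230422533850059898631486136477555195665368104552559649435603662428646792163385510744123135814843317114838042939801266843793237083711310733605114901004907045049963842341876965972816042850005520,
    941932611456932648608722992345042354718949194009737220394254825016977152626694603556122648023586060394765358947511689806913538939375646521023003775850462772932973810207766548607147167326067485001728907196890779777042587361920364489796252131366942886242278233641768423752506977006530412082165661164461371920,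
    859004577616599042528250164900081758926435867802646168999377291467619420595032190309796742376477295409028720849390440653691648482514111511322239711997961364145151546913071063891771984889945772458287442162414203736940587417673594056410870288881317678870915712758800405244357448706365664595722128900106760720] i), rfl, fun i => ⟨?_, ?_, ?_⟩, by decide, ?_, ?_⟩
  · revert i; decide +kernel
  · revert i; decide +kernel
  · revert i; decide +kernel
  · decide +kernel
  · decide +kernel

theorem exists_isGDDOp_three : ∃ g : Fin 3 × Bool → Fin 3 × Bool → Fin 3 × Bool, IsGDDOp g :=
  ⟨fun p q => (-p.1 - q.1, xor p.2 q.2), by unfold IsGDDOp; decide⟩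

theorem hasLoopTriple_of_admissible (r : ℕ) (hadm : r % 3 = 0 ∨ r % 3 = 1) (hr : 4 ≤ r) :
    HasLoopTriple r := by
  induction r using Nat.strong_induction_on with
  | _ r ih =>
    obtain ⟨g₃, hg₃⟩ := exists_isGDDOp_three
    by_cases h4 : r = 4
    · exact h4 ▸ hasLoopTriple_four
    by_cases h6 : r = 6
    · exact h6 ▸ hasLoopTriple_six
    by_cases h7 : r = 7
    · exact h7 ▸ hasLoopTriple_seven
    by_cases hodd : r % 2 = 1
    · obtain ⟨k, rfl⟩ : ∃ k, r = 2 * k + 1 := ⟨r / 2, by omega⟩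
      exact (ih k (by omega) (by omega) (by omega)).double (by omega)
    have hcases : r % 9 = 0 ∨ r % 9 = 3 ∨ r % 9 = 1 ∨ r % 9 = 7 ∨ r % 18 = 6 ∨ r % 18 = 4 := by
      omega
    rcases hcases with h | h | h | h | h | h
    · obtain ⟨k, rfl⟩ : ∃ k, r = 3 * k := ⟨r / 3, by omega⟩
      exact (ih k (by omega) (by omega) (by omega)).mul (by omega) (by omega) hg₃
    · obtain ⟨k, rfl⟩ : ∃ k, r = 3 * k := ⟨r / 3, by omega⟩
      exact (ih k (by omega) (by omega) (by omega)).mul (by omega) (by omega) hg₃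
    · obtain ⟨k, rfl⟩ : ∃ k, r = 3 * k + 1 := ⟨r / 3, by omega⟩
      exact (ih (k + 1) (by omega) (by omega) (by omega)).mul_add_one (by omega) (by omega) hg₃
    · obtain ⟨k, rfl⟩ : ∃ k, r = 3 * k + 1 := ⟨r / 3, by omega⟩
      exact (ih (k + 1) (by omega) (by omega) (by omega)).mul_add_one (by omega) (by omega) hg₃
    · obtain ⟨k, rfl⟩ : ∃ k, r = k * 6 := ⟨r / 6, by omega⟩
      obtain ⟨g, hg⟩ := (ih k (by omega) (by omega) (by omega)).exists_isGDDOp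
      exact hasLoopTriple_six.mul (by omega) (by omega) hg
    · obtain ⟨k, rfl⟩ : ∃ k, r = k * 3 + 1 := ⟨r / 3, by omega⟩
      obtain ⟨g, hg⟩ := (ih k (by omega) (by omega) (by omega)).exists_isGDDOp
      exact hasLoopTriple_four.mul_add_one (by omega) (by omega) hg

/-- An idempotent totally symmetric operation (a Steiner quasigroup). -/
structure IsSteinerQuasigroup {X : Type} (h : X → X → X) : Prop where
  comm : ∀ x y, h x y = h y x
  cancel : ∀ x y, h x (h x y) = y
  idem : ∀ x, h x x = x

/-- The triples of a Steiner quasigroup. -/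
def quasigroupTriples {X : Type} [Fintype X] [DecidableEq X] (h : X → X → X) :
    Finset (Finset X) :=
  (Finset.univ : Finset X).offDiag.image fun p => {p.1, p.2, h p.1 p.2}

namespace IsSteinerQuasigroup

variable {X : Type} {h : X → X → X}

theorem ne_left (hh : IsSteinerQuasigroup h) {x y : X} (hxy : x ≠ y) : h x y ≠ x := fun e =>
  hxy (by rw [← hh.cancel x y, e, hh.idem])

theorem ne_right (hh : IsSteinerQuasigroup h) {x y : X} (hxy : x ≠ y) : h x y ≠ y := by
  rw [hh.comm]; exact hh.ne_left hxy.symm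

variable [Fintype X] [DecidableEq X]

theorem mem_triples {b : Finset X} :
    b ∈ quasigroupTriples h ↔ ∃ x y, x ≠ y ∧ b = {x, y, h x y} := by
  simp [quasigroupTriples, eq_comm]

theorem eq_of_mem (hh : IsSteinerQuasigroup h) {b : Finset X} (hb : b ∈ quasigroupTriples h)
    {x y : X} (hx : x ∈ b) (hy : y ∈ b) (hxy : x ≠ y) : b = {x, y, h x y} := by
  obtain ⟨u, v, huv, rfl⟩ := mem_triples.1 hb
  have h1 : h u (h u v) = v := hh.cancel u v
  have h2 : h v (h u v) = u := by rw [hh.comm u v, hh.cancel]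
  have h3 : h (h u v) u = v := by rw [hh.comm, h1]
  have h4 : h (h u v) v = u := by rw [hh.comm, h2]
  have h5 : h v u = h u v := hh.comm v u
  simp only [Finset.mem_insert, Finset.mem_singleton] at hx hy
  rcases hx with rfl | rfl | rfl <;> rcases hy with rfl | rfl | rfl <;>
    first
    | exact (hxy rfl).elim
    | (simp only [h1, h2, h3, h4, h5]; try (ext z; simp; tauto))

theorem isSTS {v : ℕ} {h : Fin v → Fin v → Fin v} (hh : IsSteinerQuasigroup h) :
    IsSTS v (quasigroupTriples h) := by
  refine ⟨fun b hb => ?_, fun p hp => ?_⟩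
  · obtain ⟨x, y, hxy, rfl⟩ := mem_triples.1 hb
    exact Finset.card_eq_three.2
      ⟨x, y, h x y, hxy, (hh.ne_left hxy).symm, (hh.ne_right hxy).symm, rfl⟩
  · obtain ⟨x, y, hxy, rfl⟩ := Finset.card_eq_two.1 hp
    refine ⟨{x, y, h x y}, ⟨mem_triples.2 ⟨x, y, hxy, rfl⟩, ?_⟩, fun b hb => ?_⟩
    · intro z; simp; tauto
    · exact hh.eq_of_mem hb.1 (hb.2 (by simp)) (hb.2 (by simp)) hxy

theorem card_flower (hh : IsSteinerQuasigroup h) (x : X) {r : ℕ}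
    (hc : Fintype.card X = 2 * r + 1) :
    ((quasigroupTriples h).filter fun b => x ∈ b).card = r := by
  have hmaps : ∀ y ∈ Finset.univ.erase x, ({x, y, h x y} : Finset X) ∈
      (quasigroupTriples h).filter fun b => x ∈ b := fun y hy => by
    simp only [Finset.mem_filter, Finset.mem_insert, true_or, and_true]
    exact mem_triples.2 ⟨x, y, (Finset.ne_of_mem_erase hy).symm, rfl⟩
  have hsum := Finset.card_eq_sum_card_fiberwise hmaps
  rw [Finset.sum_congr rfl (g := fun _ => 2), Finset.sum_const,
    Finset.card_erase_of_mem (Finset.mem_univ x), Finset.card_univ, hc, smul_eq_mul] at hsum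
  · omega
  · intro b hb
    obtain ⟨hb, hx⟩ := Finset.mem_filter.1 hb
    have hb3 : b.card = 3 := by
      obtain ⟨u, v, huv, rfl⟩ := mem_triples.1 hb
      exact Finset.card_eq_three.2
        ⟨u, v, h u v, huv, (hh.ne_left huv).symm, (hh.ne_right huv).symm, rfl⟩
    have : (Finset.univ.erase x).filter (fun y => ({x, y, h x y} : Finset X) = b) =
        b.erase x := by
      ext y
      simp only [Finset.mem_filter, Finset.mem_erase, Finset.mem_univ, and_true]
      refine and_congr_right fun hy => ⟨fun e => by simp [← e], fun hyb => ?_⟩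
      exact (hh.eq_of_mem hb hx hyb hy.symm).symm
    rw [this, Finset.card_erase_of_mem hx, hb3]

end IsSteinerQuasigroup

theorem exists_isSteinerQuasigroup {L X : Type} [DecidableEq X] {one : L} {f : L → L → L}
    (hf : IsSteinerLoop one f) (ψ : X ≃ {x : L // x ≠ one}) :
    ∃ h : X → X → X, IsSteinerQuasigroup h ∧ ∀ x y, x ≠ y → (ψ (h x y) : L) = f (ψ x) (ψ y) := by
  have hex : ∀ x y : X, ∃ z, (x = y → z = x) ∧ (x ≠ y → (ψ z : L) = f (ψ x) (ψ y)) := by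
    intro x y
    by_cases hxy : x = y
    · exact ⟨x, fun _ => rfl, fun h => (h hxy).elim⟩
    · have h1 : f (ψ x) (ψ y) ≠ one := by
        rw [ne_eq, hf.mul_eq_one, ← Subtype.ext_iff, ψ.injective.eq_iff]
        exact Ne.symm hxy
      exact ⟨ψ.symm ⟨_, h1⟩, fun h => (hxy h).elim, fun _ => by simp⟩
  choose h hid hop using hex
  have hinj : ∀ x y, (ψ x : L) = ψ y → x = y := fun x y e => ψ.injective (Subtype.ext e)
  refine ⟨h, ⟨fun x y => ?_, fun x y => ?_, fun x => hid x x rfl⟩, hop⟩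
  · by_cases hxy : x = y
    · rw [hxy]
    · exact hinj _ _ (by rw [hop x y hxy, hop y x (Ne.symm hxy), hf.comm])
  · by_cases hxy : x = y
    · subst hxy
      rw [hid x x rfl, hid x x rfl]
    · have hne : x ≠ h x y := fun e => (ψ y).2 (by
        have := hop x y hxy
        rw [← e] at this
        exact hf.mul_eq_left.1 this.symm)
      exact hinj _ _ (by rw [hop _ _ hne, hop x y hxy, hf.cancel])

theorem HasLoopTriple.zero_mem_J3F {r : ℕ} (h : HasLoopTriple r) : 0 ∈ J3F r := by
  classical
  obtain ⟨L, _, one, e, f, hc, h⟩ := h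
  have hcard : Fintype.card (Fin (2 * r + 1)) = Fintype.card {x : L // x ≠ one} := by
    rw [Fintype.card_fin, Fintype.card_subtype_compl, hc, Fintype.card_subtype_eq]; rfl
  let ψ := Fintype.equivOfCardEq hcard
  choose q hq hop using fun i => exists_isSteinerQuasigroup (h.loop i) ψ
  obtain ⟨x₀, hx₀⟩ : ∃ x₀, (ψ x₀ : L) = e := ⟨ψ.symm ⟨e, h.ne⟩, by simp⟩
  have hψ : ∀ x, (ψ x : L) = e → x = x₀ := fun x hx =>
    ψ.injective (Subtype.ext (hx.trans hx₀.symm))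
  have hfl : ∀ i j, flowerAt (quasigroupTriples (q i)) x₀ ⊆ quasigroupTriples (q j) := by
    intro i j b hb
    obtain ⟨hb, hx⟩ := Finset.mem_filter.1 hb
    obtain ⟨y, hy, hyx⟩ := Finset.exists_mem_ne (s := b)
      (by rw [(hq i).isSTS.1 b hb]; omega) x₀
    rw [(hq i).eq_of_mem hb hx hy hyx.symm]
    refine IsSteinerQuasigroup.mem_triples.2 ⟨x₀, y, hyx.symm, ?_⟩
    have : q i x₀ y = q j x₀ y := ψ.injective (Subtype.ext (by
      rw [hop i _ _ hyx.symm, hop j _ _ hyx.symm, hx₀, h.flower i j]))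
    rw [this]
  have hint : ∀ i j, i ≠ j → quasigroupTriples (q i) ∩ quasigroupTriples (q j) =
      flowerAt (quasigroupTriples (q i)) x₀ := by
    intro i j hij
    refine Finset.Subset.antisymm (fun b hb => ?_) fun b hb =>
      Finset.mem_inter.2 ⟨Finset.mem_of_mem_filter b hb, hfl i j hb⟩
    obtain ⟨hbi, hbj⟩ := Finset.mem_inter.1 hb
    refine Finset.mem_filter.2 ⟨hbi, ?_⟩
    obtain ⟨x, y, hxy, rfl⟩ := IsSteinerQuasigroup.mem_triples.1 hbi
    have heq := (hq j).eq_of_mem hbj (x := x) (y := y) (by simp) (by simp) hxy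
    have hz : q i x y ∈ ({x, y, q j x y} : Finset _) := heq ▸ by simp
    simp only [Finset.mem_insert, Finset.mem_singleton, (hq i).ne_left hxy,
      (hq i).ne_right hxy, false_or] at hz
    have := h.disj i j (ψ x) (ψ y) hij (by rw [← hop i x y hxy, ← hop j x y hxy, hz])
    rw [← hop i x y hxy] at this
    simp only [(ψ _).2, false_or] at this
    rcases this with h | h | h <;> simp [← hψ _ h]
  have hflow : ∀ i j, flowerAt (quasigroupTriples (q i)) x₀ =
      flowerAt (quasigroupTriples (q j)) x₀ := fun i j =>
    Finset.Subset.antisymm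
      (fun b hb => Finset.mem_filter.2 ⟨hfl i j hb, (Finset.mem_filter.1 hb).2⟩)
      (fun b hb => Finset.mem_filter.2 ⟨hfl j i hb, (Finset.mem_filter.1 hb).2⟩)
  have hcf : (flowerAt (quasigroupTriples (q 0)) x₀).card = r :=
    (hq 0).card_flower x₀ (Fintype.card_fin _)
  refine ⟨quasigroupTriples (q 0), quasigroupTriples (q 1), quasigroupTriples (q 2), x₀,
    (hq 0).isSTS, (hq 1).isSTS, (hq 2).isSTS, ?_, ?_, ?_, hflow 0 1, hflow 0 2, hcf⟩
  · rw [hint 0 1 (by decide), hint 0 2 (by decide)]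
  · rw [hint 0 1 (by decide), hint 1 2 (by decide), hflow 0 1]
  · rw [hint 0 1 (by decide), hcf, zero_add]

/-- For every admissible `r ≥ 4`, `0 ∈ J³_F(r)`. -/
theorem stmt10 (r : ℕ) (hadm : r % 3 = 0 ∨ r % 3 = 1) (hr : 4 ≤ r) :
    0 ∈ J3F r :=
  (hasLoopTriple_of_admissible r hadm hr).zero_mem_J3F
end

section
/- Let v = 2r + 1 ≡ 1 or 3 (mod 6) with r ≥ 6, and let k ≥ 2r(r−3)/3. If k + r ∈ J³(v), then k ∈ J³_F(r). -/
namespace IsSTS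

variable {v : ℕ} {B : Finset (Finset (Fin v))}

theorem eq_of_mem (h : IsSTS v B) {s t : Finset (Fin v)} {x y : Fin v} (hxy : x ≠ y)
    (hs : s ∈ B) (ht : t ∈ B) (hxs : x ∈ s) (hys : y ∈ s) (hxt : x ∈ t) (hyt : y ∈ t) :
    s = t :=
  (h.2 {x, y} (Finset.card_pair hxy)).unique
    ⟨hs, by simp [Finset.insert_subset_iff, hxs, hys]⟩
    ⟨ht, by simp [Finset.insert_subset_iff, hxt, hyt]⟩

theorem exists_mem (h : IsSTS v B) {x y : Fin v} (hxy : x ≠ y) : ∃ s ∈ B, x ∈ s ∧ y ∈ s := by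
  obtain ⟨s, ⟨hs, hsub⟩, -⟩ := h.2 {x, y} (Finset.card_pair hxy)
  exact ⟨s, hs, hsub (by simp), hsub (by simp)⟩

/-- A triple of an STS has a third point besides any two given points. -/
theorem exists_third (h : IsSTS v B) {s : Finset (Fin v)} (hs : s ∈ B) (x y : Fin v) :
    ∃ z ∈ s, z ≠ x ∧ z ≠ y := by
  have hlt : ({x, y} : Finset (Fin v)).card < s.card := by
    have := Finset.card_le_two (a := x) (b := y)
    have := h.1 s hs
    omega
  obtain ⟨z, hz, hz'⟩ := Finset.exists_mem_notMem_of_card_lt_card hlt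
  exact ⟨z, hz, by grind, by grind⟩

theorem eq_triple (h : IsSTS v B) {s : Finset (Fin v)} (hs : s ∈ B) {x y z : Fin v}
    (hxy : x ≠ y) (hzx : z ≠ x) (hzy : z ≠ y) (hx : x ∈ s) (hy : y ∈ s) (hz : z ∈ s) :
    s = {x, y, z} := by
  symm
  apply Finset.eq_of_subset_of_card_le
  · simp [Finset.insert_subset_iff, hx, hy, hz]
  · rw [h.1 s hs, Finset.card_eq_three.2 ⟨x, y, z, hxy, hzx.symm, hzy.symm, rfl⟩]

theorem two_mul_card_flowerAt (h : IsSTS v B) (x : Fin v) :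
    2 * (flowerAt B x).card = v - 1 := by
  have key := Finset.sum_card_bipartiteAbove_eq_sum_card_bipartiteBelow
    (s := flowerAt B x) (t := Finset.univ.erase x) (fun b y => y ∈ b)
  have hl : ∀ b ∈ flowerAt B x,
      (Finset.bipartiteAbove (fun b y => y ∈ b) (Finset.univ.erase x) b).card = 2 := by
    intro b hb
    obtain ⟨hb, hx⟩ := Finset.mem_filter.1 hb
    have : Finset.bipartiteAbove (fun b y => y ∈ b) (Finset.univ.erase x) b = b.erase x := by
      ext y; simp [Finset.bipartiteAbove]
    rw [this, Finset.card_erase_of_mem hx, h.1 b hb]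
  have hr : ∀ y ∈ Finset.univ.erase x,
      (Finset.bipartiteBelow (fun b y => y ∈ b) (flowerAt B x) y).card = 1 := by
    intro y hy
    have hxy : x ≠ y := (Finset.ne_of_mem_erase hy).symm
    obtain ⟨s, hs, hxs, hys⟩ := h.exists_mem hxy
    refine Finset.card_eq_one.2 ⟨s, Finset.eq_singleton_iff_unique_mem.2 ⟨?_, fun t ht => ?_⟩⟩
    · simp [Finset.bipartiteBelow, flowerAt, hs, hxs, hys]
    · simp only [Finset.bipartiteBelow, flowerAt, Finset.mem_filter] at ht
      exact h.eq_of_mem hxy ht.1.1 hs ht.1.2 ht.2 hxs hys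
  rw [Finset.sum_congr rfl hl, Finset.sum_congr rfl hr] at key
  simp at key
  omega

end IsSTS

theorem sum_card_flowerAt {v : ℕ} {B : Finset (Finset (Fin v))} (h : ∀ b ∈ B, b.card = 3) :
    ∑ x, (flowerAt B x).card = 3 * B.card := by
  have key := Finset.sum_card_bipartiteAbove_eq_sum_card_bipartiteBelow
    (s := B) (t := Finset.univ) (fun b (x : Fin v) => x ∈ b)
  simp only [Finset.bipartiteAbove, Finset.bipartiteBelow, Finset.filter_univ_mem] at key
  rw [Finset.sum_congr rfl h] at key
  simp only [flowerAt]
  rw [← key]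
  simp [mul_comm]

section Trade

variable {v : ℕ} {B₁ B₂ B₃ : Finset (Finset (Fin v))}

/-- Let `p ∈ B₁ \ B₂` contain `x` and `a`, and let `c`, `d` be the points completing `{x, a}` to
a triple of `B₂`, `B₃`. Then at least two triples of `B₁ \ B₂` contain `x`, and if there are
exactly two then `x, c, d` lie in a triple of `B₁` avoiding `a`. -/
theorem two_le_card_flowerAt_sdiff (h₁ : IsSTS v B₁) (h₂ : IsSTS v B₂) (h₃ : IsSTS v B₃)
    (h12 : B₁ ∩ B₂ = B₁ ∩ B₃) (h23 : B₁ ∩ B₂ = B₂ ∩ B₃) {p q w : Finset (Fin v)}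
    {x a c d : Fin v} (hp₁ : p ∈ B₁) (hp₂ : p ∉ B₂) (hq : q ∈ B₂) (hw : w ∈ B₃) (hxa : x ≠ a)
    (hxp : x ∈ p) (hap : a ∈ p) (hxq : x ∈ q) (haq : a ∈ q) (hxw : x ∈ w) (haw : a ∈ w)
    (hcq : c ∈ q) (hcx : c ≠ x) (hca : c ≠ a) (hdw : d ∈ w) (hdx : d ≠ x) (hda : d ≠ a) :
    c ≠ d ∧ 2 ≤ (flowerAt (B₁ \ B₂) x).card ∧
      ((flowerAt (B₁ \ B₂) x).card ≤ 2 → ∃ s ∈ B₁, x ∈ s ∧ c ∈ s ∧ d ∈ s ∧ a ∉ s) := by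
  have mem₂_iff : ∀ s ∈ B₁, s ∈ B₂ ↔ s ∈ B₃ := by
    intro s hs
    simpa [hs] using Finset.ext_iff.1 h12 s
  have mem₁_of : ∀ s ∈ B₂, s ∈ B₃ → s ∈ B₁ := by
    intro s hs hs'
    simpa [hs, hs'] using Finset.ext_iff.1 h23 s
  have hcp : c ∉ p := by
    intro hcp
    apply hp₂
    rwa [h₁.eq_triple hp₁ hxa hcx hca hxp hap hcp, ← h₂.eq_triple hq hxa hcx hca hxq haq hcq]
  have hdp : d ∉ p := by
    intro hdp
    apply hp₂
    rw [mem₂_iff p hp₁]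
    rwa [h₁.eq_triple hp₁ hxa hdx hda hxp hap hdp, ← h₃.eq_triple hw hxa hdx hda hxw haw hdw]
  have hcd : c ≠ d := by
    rintro rfl
    have hqw : q = w := by
      rw [h₂.eq_triple hq hxa hcx hca hxq haq hcq, h₃.eq_triple hw hxa hcx hca hxw haw hdw]
    subst hqw
    exact hcp (h₁.eq_of_mem hxa (mem₁_of q hq hw) hp₁ hxq haq hxp hap ▸ hcq)
  obtain ⟨s, hs, hxs, hcs⟩ := h₁.exists_mem hcx.symm
  obtain ⟨t, ht, hxt, hdt⟩ := h₁.exists_mem hdx.symm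
  have has : a ∉ s := fun has => hcp (h₁.eq_of_mem hxa hs hp₁ hxs has hxp hap ▸ hcs)
  have hat : a ∉ t := fun hat => hdp (h₁.eq_of_mem hxa ht hp₁ hxt hat hxp hap ▸ hdt)
  have hs₂ : s ∉ B₂ := fun hs₂ => has (h₂.eq_of_mem hcx hs₂ hq hcs hxs hcq hxq ▸ haq)
  have ht₂ : t ∉ B₂ := fun ht₂ =>
    hat (h₃.eq_of_mem hdx ((mem₂_iff t ht).1 ht₂) hw hdt hxt hdw hxw ▸ haw)
  have hps : p ≠ s := fun h => hcp (h ▸ hcs)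
  have hpt : p ≠ t := fun h => hdp (h ▸ hdt)
  have hsub : ({p, s} : Finset (Finset (Fin v))) ⊆ flowerAt (B₁ \ B₂) x := by
    simp [Finset.insert_subset_iff, flowerAt, hp₁, hp₂, hxp, hs, hs₂, hxs]
  have hcard := Finset.card_pair hps
  refine ⟨hcd, hcard ▸ Finset.card_le_card hsub, fun hle => ⟨s, hs, hxs, hcs, ?_, has⟩⟩
  have heq := Finset.eq_of_subset_of_card_le hsub (hle.trans hcard.ge)
  have hmem : t ∈ ({p, s} : Finset (Finset (Fin v))) := by
    rw [heq]
    simp [flowerAt, ht, ht₂, hxt]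
  rw [Finset.mem_insert, Finset.mem_singleton] at hmem
  exact hmem.resolve_left hpt.symm ▸ hdt

/-- Every point on a triple of `B₁ \ B₂` is on at least two of them, and it or another point
is on at least three. -/
theorem two_le_card_and_exists_three_le (h₁ : IsSTS v B₁) (h₂ : IsSTS v B₂) (h₃ : IsSTS v B₃)
    (h12 : B₁ ∩ B₂ = B₁ ∩ B₃) (h23 : B₁ ∩ B₂ = B₂ ∩ B₃) {x : Fin v}
    (hx : (flowerAt (B₁ \ B₂) x).Nonempty) :
    2 ≤ (flowerAt (B₁ \ B₂) x).card ∧ ∃ y, 3 ≤ (flowerAt (B₁ \ B₂) y).card := by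
  obtain ⟨p, hp⟩ := hx
  simp only [flowerAt, Finset.mem_filter, Finset.mem_sdiff] at hp
  obtain ⟨⟨hp₁, hp₂⟩, hxp⟩ := hp
  obtain ⟨a, hap, hax, -⟩ := h₁.exists_third hp₁ x x
  obtain ⟨q, hq, hxq, haq⟩ := h₂.exists_mem hax.symm
  obtain ⟨w, hw, hxw, haw⟩ := h₃.exists_mem hax.symm
  obtain ⟨c, hcq, hcx, hca⟩ := h₂.exists_third hq x a
  obtain ⟨d, hdw, hdx, hda⟩ := h₃.exists_third hw x a
  obtain ⟨hcd, hx2, hx3⟩ := two_le_card_flowerAt_sdiff h₁ h₂ h₃ h12 h23 hp₁ hp₂ hq hw hax.symm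
    hxp hap hxq haq hxw haw hcq hcx hca hdw hdx hda
  obtain ⟨-, -, ha3⟩ := two_le_card_flowerAt_sdiff h₁ h₂ h₃ h12 h23 hp₁ hp₂ hq hw hax
    hap hxp haq hxq haw hxw hcq hca hcx hdw hda hdx
  refine ⟨hx2, ?_⟩
  by_contra! hlt
  obtain ⟨s, hs, -, hcs, hds, has⟩ := hx3 (Nat.le_of_lt_succ (hlt x))
  obtain ⟨t, ht, hat, hct, hdt, -⟩ := ha3 (Nat.le_of_lt_succ (hlt a))
  exact has (h₁.eq_of_mem hcd hs ht hcs hds hct hdt ▸ hat)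

/-- Unless some point is on no triple of `B₁ \ B₂`, that set has more than `2v/3` triples. -/
theorem two_mul_lt_three_mul_card_sdiff (hv : 0 < v) (h₁ : IsSTS v B₁) (h₂ : IsSTS v B₂)
    (h₃ : IsSTS v B₃) (h12 : B₁ ∩ B₂ = B₁ ∩ B₃) (h23 : B₁ ∩ B₂ = B₂ ∩ B₃)
    (h : ∀ x, (flowerAt (B₁ \ B₂) x).Nonempty) : 2 * v < 3 * (B₁ \ B₂).card := by
  have key x := two_le_card_and_exists_three_le h₁ h₂ h₃ h12 h23 (h x)
  obtain ⟨y, hy⟩ := (key ⟨0, hv⟩).2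
  rw [← sum_card_flowerAt fun b hb => h₁.1 b (Finset.mem_sdiff.1 hb).1]
  calc 2 * v = ∑ _x : Fin v, 2 := by simp [mul_comm]
    _ < _ := Finset.sum_lt_sum (fun x _ => (key x).1) ⟨y, Finset.mem_univ y, hy⟩

end Trade

/-- Let `v = 2r+1 ≡ 1, 3 (mod 6)` with `r ≥ 6` and `k ≥ 2r(r-3)/3`.
If `k + r ∈ J³(v)` then `k ∈ J³_F(r)`. -/
theorem stmt12 (r : ℕ) (hr : 6 ≤ r)
    (hv : (2 * r + 1) % 6 = 1 ∨ (2 * r + 1) % 6 = 3)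
    (k : ℕ) (hk : 2 * r * (r - 3) / 3 ≤ k)
    (h : k + r ∈ J3 (2 * r + 1)) : k ∈ J3F r := by
  obtain ⟨B₁, B₂, B₃, h₁, h₂, h₃, h12, h23, hcard⟩ := h
  have hfl : ∀ {B : Finset (Finset (Fin (2 * r + 1)))}, IsSTS (2 * r + 1) B → ∀ x,
      (flowerAt B x).card = r := by
    intro B hB x
    have := hB.two_mul_card_flowerAt x
    omega
  have hB₁ : (2 * r + 1) * r = 3 * B₁.card := by
    rw [← sum_card_flowerAt h₁.1]
    simp [hfl h₁]
  have hsd : (B₁ \ B₂).card + (B₁ ∩ B₂).card = B₁.card := Finset.card_sdiff_add_card_inter B₁ B₂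
  obtain ⟨x, hx⟩ : ∃ x, flowerAt (B₁ \ B₂) x = ∅ := by
    by_contra! hne
    have hlt := two_mul_lt_three_mul_card_sdiff (by omega) h₁ h₂ h₃ h12 h23 hne
    obtain ⟨m, rfl⟩ := Nat.exists_eq_add_of_le hr
    have hm : 6 + m - 3 = m + 3 := by omega
    rw [hm] at hk
    have hk' : 2 * (6 + m) * (m + 3) ≤ 3 * k + 2 := by omega
    nlinarith
  have hmem : ∀ b ∈ flowerAt B₁ x, b ∈ B₁ ∩ B₂ := by
    intro b hb
    obtain ⟨hb₁, hxb⟩ := Finset.mem_filter.1 hb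
    refine Finset.mem_inter.2 ⟨hb₁, ?_⟩
    by_contra hb₂
    have : b ∈ flowerAt (B₁ \ B₂) x := by simp [flowerAt, *]
    simp [hx] at this
  have hflower : ∀ {B : Finset (Finset (Fin (2 * r + 1)))}, IsSTS (2 * r + 1) B →
      B₁ ∩ B₂ ⊆ B → flowerAt B₁ x = flowerAt B x := by
    intro B hB hsub
    apply Finset.eq_of_subset_of_card_le
    · intro b hb
      exact Finset.mem_filter.2 ⟨hsub (hmem b hb), (Finset.mem_filter.1 hb).2⟩
    · rw [hfl h₁, hfl hB]
  exact ⟨B₁, B₂, B₃, x, h₁, h₂, h₃, h12, h23, hcard, hflower h₂ Finset.inter_subset_right,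
    hflower h₃ (h12 ▸ Finset.inter_subset_right), hfl h₁ x⟩
end

section
/- J³_F(4) = {0, 8}; that is, three STS(9)'s on a common point set whose pairwise intersections all equal the same set of k + 4 triples, 4 of which form the flower at a common point, exist exactly for k ∈ {0, 8}. -/
/-- The equational laws of a Steiner quasigroup. -/
structure IsSteinerQuasigroup_s15 {α : Type*} (f : α → α → α) : Prop where
  idem : ∀ a, f a a = a
  comm : ∀ a b, f a b = f b a
  cancel : ∀ a b, f a (f a b) = b

theorem IsSteinerQuasigroup_s15.conj {α β : Type*} {f : α → α → α} (hf : IsSteinerQuasigroup_s15 f)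
    (e : β ≃ α) : IsSteinerQuasigroup_s15 fun i j => e.symm (f (e i) (e j)) where
  idem a := by simp [hf.idem]
  comm a b := by simp [hf.comm (e a) (e b)]
  cancel a b := by simp [hf.cancel]

/-- Every Steiner triple system is encoded by a Steiner quasigroup. -/
theorem IsSTS.exists_quasigroup {v : ℕ} {B : Finset (Finset (Fin v))} (h : IsSTS v B) :
    ∃ f : Fin v → Fin v → Fin v, IsSteinerQuasigroup_s15 f ∧
      ∀ i j k, i ≠ j → i ≠ k → j ≠ k → ({i, j, k} ∈ B ↔ f i j = k) := by
  have third : ∀ i j : Fin v, ∃ k, (i = j → k = i) ∧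
      (i ≠ j → i ≠ k ∧ j ≠ k ∧ ({i, j, k} : Finset (Fin v)) ∈ B) := by
    intro i j
    by_cases hij : i = j
    · exact ⟨i, fun _ => rfl, fun hne => absurd hij hne⟩
    obtain ⟨b, ⟨hb, hsub⟩, -⟩ := h.2 {i, j} (Finset.card_pair hij)
    have hc : (b \ {i, j}).card = 1 := by
      rw [Finset.card_sdiff_of_subset hsub, h.1 b hb, Finset.card_pair hij]
    obtain ⟨k, hk⟩ := Finset.card_eq_one.1 hc
    have hkm : k ∈ b \ {i, j} := by simp [hk]
    have hb' : b = {i, j, k} := by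
      rw [← Finset.union_sdiff_of_subset hsub, hk]
      ext z
      simp
    simp only [Finset.mem_sdiff, Finset.mem_insert, Finset.mem_singleton, not_or] at hkm
    exact ⟨k, fun e => absurd e hij, fun _ => ⟨Ne.symm hkm.2.1, Ne.symm hkm.2.2, hb' ▸ hb⟩⟩
  choose f hself hthird using third
  have huniq : ∀ i j k, i ≠ j → i ≠ k → j ≠ k → {i, j, k} ∈ B → f i j = k := by
    intro i j k hij hik hjk hB
    obtain ⟨h1, h2, h3⟩ := hthird i j hij
    have heq := (h.2 {i, j} (Finset.card_pair hij)).unique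
      ⟨h3, by grind⟩ ⟨hB, by grind⟩
    have : f i j ∈ ({i, j, k} : Finset (Fin v)) := heq ▸ by simp
    grind
  refine ⟨f, ⟨fun a => hself a a rfl, fun a b => ?_, fun a b => ?_⟩, fun i j k hij hik hjk =>
    ⟨huniq i j k hij hik hjk, ?_⟩⟩
  · by_cases hab : a = b
    · rw [hab]
    obtain ⟨h1, h2, h3⟩ := hthird b a (Ne.symm hab)
    exact huniq a b _ hab h2 h1 (Finset.insert_comm b a _ ▸ h3)
  · by_cases hab : a = b
    · rw [← hab, hself a a rfl, hself a a rfl]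
    obtain ⟨h1, h2, h3⟩ := hthird a b hab
    exact huniq a _ b h1 hab (Ne.symm h2) (Finset.pair_comm b (f a b) ▸ h3)
  · rintro rfl
    exact (hthird i j hij).2.2

/-- Counting pairs of points: an `STS(v)` has `v(v-1)/6` triples. -/
theorem IsSTS.three_mul_card {v : ℕ} {B : Finset (Finset (Fin v))} (h : IsSTS v B) :
    3 * B.card = v.choose 2 := by
  have key := Finset.sum_card_bipartiteAbove_eq_sum_card_bipartiteBelow
    (s := (Finset.univ : Finset (Fin v)).powersetCard 2) (t := B) (fun p b => p ⊆ b)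
  have h1 : ∀ p ∈ (Finset.univ : Finset (Fin v)).powersetCard 2,
      (B.bipartiteAbove (fun p b => p ⊆ b) p).card = 1 := by
    intro p hp
    obtain ⟨b, hb, hu⟩ := h.2 p (Finset.mem_powersetCard.1 hp).2
    refine Finset.card_eq_one.2 ⟨b, ?_⟩
    ext c
    simp only [Finset.mem_bipartiteAbove, Finset.mem_singleton]
    exact ⟨fun hc => hu c hc, fun hc => hc ▸ hb⟩
  have h2 : ∀ b ∈ B, (((Finset.univ : Finset (Fin v)).powersetCard 2).bipartiteBelow
      (fun p b => p ⊆ b) b).card = 3 := by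
    intro b hb
    have : ((Finset.univ : Finset (Fin v)).powersetCard 2).bipartiteBelow
      (fun p b => p ⊆ b) b = b.powersetCard 2 := by
      ext p
      simp [Finset.mem_bipartiteBelow, Finset.mem_powersetCard, and_comm]
    rw [this, Finset.card_powersetCard, h.1 b hb]
    rfl
  rw [Finset.sum_congr rfl h1, Finset.sum_congr rfl h2] at key
  simp at key
  omega

/-- Standard position of a flower at `0` together with one further triple `{1, 2, 3}`. -/
structure IsStandard (f : Fin 9 → Fin 9 → Fin 9) : Prop extends IsSteinerQuasigroup_s15 f where
  h01 : f 0 1 = 4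
  h02 : f 0 2 = 5
  h03 : f 0 3 = 6
  h07 : f 0 7 = 8
  h12 : f 1 2 = 3

theorem IsStandard.one_five {f : Fin 9 → Fin 9 → Fin 9} (h : IsStandard f) :
    f 1 5 = 7 ∨ f 1 5 = 8 := by
  obtain ⟨⟨hi, hc, hk⟩, h01, h02, h03, h07, h12⟩ := h
  have key : ∀ i j k, f i j = k → f i k = j := fun i j k e => e ▸ hk i j
  have h56 : f 1 5 ≠ 6 := by
    intro h6
    have h7 : ∀ k, f 1 7 = k → False := by
      intro k hk7
      have := key _ _ _ hk7
      fin_cases k <;> grind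
    exact h7 _ rfl
  generalize hv : f 1 5 = v at *
  have := key _ _ _ hv
  fin_cases v <;> grind

/-- In standard position, the value `f 1 5` determines the remaining triples. -/
theorem IsStandard.values {f : Fin 9 → Fin 9 → Fin 9} (h : IsStandard f) {u w : Fin 9}
    (huw : u = 7 ∧ w = 8 ∨ u = 8 ∧ w = 7) (h15 : f 1 5 = u) :
    f 1 w = 6 ∧ f 2 w = 4 ∧ f 2 u = 6 ∧ f 3 w = 5 ∧ f 3 u = 4 ∧ f 4 5 = 6 := by
  obtain ⟨⟨hi, hc, hk⟩, h01, h02, h03, h07, h12⟩ := h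
  have key : ∀ i j k, f i j = k → f i k = j := fun i j k e => e ▸ hk i j
  have h1w : f 1 w = 6 := by
    generalize hv : f 1 w = v at *
    have := key _ _ _ hv
    fin_cases v <;> grind
  have h2w : f 2 w = 4 := by
    generalize hv : f 2 w = v at *
    have := key _ _ _ hv
    fin_cases v <;> grind
  have h2u : f 2 u = 6 := by
    generalize hv : f 2 u = v at *
    have := key _ _ _ hv
    fin_cases v <;> grind
  have h3w : f 3 w = 5 := by
    generalize hv : f 3 w = v at *
    have := key _ _ _ hv
    fin_cases v <;> grind
  have h3u : f 3 u = 4 := by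
    generalize hv : f 3 u = v at *
    have := key _ _ _ hv
    fin_cases v <;> grind
  have h45 : f 4 5 = 6 := by
    generalize hv : f 4 5 = v at *
    have := key _ _ _ hv
    fin_cases v <;> grind
  exact ⟨h1w, h2w, h2u, h3w, h3u, h45⟩

/-- In standard position, the value `f 1 5` determines `f`. -/
theorem IsStandard.eq {f g : Fin 9 → Fin 9 → Fin 9} (hf : IsStandard f) (hg : IsStandard g)
    (h : f 1 5 = g 1 5) : f = g := by
  obtain ⟨u, w, huw, h15⟩ : ∃ u w : Fin 9, (u = 7 ∧ w = 8 ∨ u = 8 ∧ w = 7) ∧ f 1 5 = u := by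
    rcases hf.one_five with e | e
    · exact ⟨7, 8, Or.inl ⟨rfl, rfl⟩, e⟩
    · exact ⟨8, 7, Or.inr ⟨rfl, rfl⟩, e⟩
  have hvf := hf.values huw h15
  have hvg := hg.values huw (h ▸ h15)
  obtain ⟨⟨hi, hc, hk⟩, h01, h02, h03, h07, h12⟩ := hf
  obtain ⟨⟨hi', hc', hk'⟩, h01', h02', h03', h07', h12'⟩ := hg
  have rot : ∀ i j k, f i j = k → g i j = k → f i k = g i k ∧ f j k = g j k ∧ f i j = g i j := by
    intro i j k e e'
    have e2 : f j i = k := hc i j ▸ e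
    have e2' : g j i = k := hc' i j ▸ e'
    grind
  have symm : ∀ i j, f i j = g i j → f j i = g j i := by
    intro i j e
    rw [hc, hc' j, e]
  have r014 := rot 0 1 4 h01 h01'
  have r025 := rot 0 2 5 h02 h02'
  have r036 := rot 0 3 6 h03 h03'
  have r078 := rot 0 7 8 h07 h07'
  have r123 := rot 1 2 3 h12 h12'
  have r15u := rot 1 5 u h15 (h ▸ h15)
  have r16w := rot 1 w 6 hvf.1 hvg.1
  have r24w := rot 2 w 4 hvf.2.1 hvg.2.1
  have r26u := rot 2 u 6 hvf.2.2.1 hvg.2.2.1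
  have r35w := rot 3 w 5 hvf.2.2.2.1 hvg.2.2.2.1
  have r34u := rot 3 u 4 hvf.2.2.2.2.1 hvg.2.2.2.2.1
  have r456 := rot 4 5 6 hvf.2.2.2.2.2 hvg.2.2.2.2.2
  clear rot hvf hvg hk hk'
  have upper : ∀ i j, i < j → f i j = g i j := by
    intro i j hij
    rcases huw with ⟨rfl, rfl⟩ | ⟨rfl, rfl⟩ <;> fin_cases i <;> fin_cases j <;>
      first
        | exact absurd hij (by decide)
        | (simp only [Fin.reduceFinMk, Fin.zero_eta, Fin.mk_one]; tauto)
  ext1 i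
  ext1 j
  rcases lt_trichotomy i j with hij | rfl | hij
  · exact upper i j hij
  · rw [hi, hi']
  · exact symm _ _ (upper j i hij)

/-- The quasigroup of a Steiner triple system determines the system. -/
theorem IsSTS.eq_of_quasigroup_eq {v : ℕ} {B C : Finset (Finset (Fin v))} (hB : IsSTS v B)
    (hC : IsSTS v C) {f : Fin v → Fin v → Fin v}
    (hfB : ∀ i j k, i ≠ j → i ≠ k → j ≠ k → ({i, j, k} ∈ B ↔ f i j = k))
    (hfC : ∀ i j k, i ≠ j → i ≠ k → j ≠ k → ({i, j, k} ∈ C ↔ f i j = k)) : B = C := by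
  ext t
  constructor <;> intro ht
  · obtain ⟨a, b, c, hab, hac, hbc, rfl⟩ := Finset.card_eq_three.1 (hB.1 t ht)
    rwa [hfC a b c hab hac hbc, ← hfB a b c hab hac hbc]
  · obtain ⟨a, b, c, hab, hac, hbc, rfl⟩ := Finset.card_eq_three.1 (hC.1 t ht)
    rwa [hfB a b c hab hac hbc, ← hfC a b c hab hac hbc]

/-- Systems with the same flower at `x` have the same products with `x`. -/
theorem eq_of_flowerAt_eq {v : ℕ} {B C : Finset (Finset (Fin v))} {f g : Fin v → Fin v → Fin v}
    (hf : IsSteinerQuasigroup_s15 f) (hg : IsSteinerQuasigroup_s15 g)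
    (hfB : ∀ i j k, i ≠ j → i ≠ k → j ≠ k → ({i, j, k} ∈ B ↔ f i j = k))
    (hgC : ∀ i j k, i ≠ j → i ≠ k → j ≠ k → ({i, j, k} ∈ C ↔ g i j = k))
    {x : Fin v} (h : flowerAt B x = flowerAt C x) (y : Fin v) : f x y = g x y := by
  by_cases hxy : x = y
  · rw [← hxy, hf.idem, hg.idem]
  have h1 : x ≠ f x y := fun e => hxy (by rw [← hf.cancel x y, ← e, hf.idem])
  have h2 : y ≠ f x y := fun e => hxy (by
    rw [← hf.cancel y x, hf.comm y x, ← e, hf.idem])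
  have hm : {x, y, f x y} ∈ flowerAt B x :=
    Finset.mem_filter.2 ⟨(hfB x y _ hxy h1 h2).2 rfl, by simp⟩
  rw [h] at hm
  exact ((hgC x y _ hxy h1 h2).1 (Finset.mem_filter.1 hm).1).symm

/-- Among three Steiner quasigroups of order 9 that share a flower and a triple outside it,
two coincide. -/
theorem exists_eq_of_common {f g h : Fin 9 → Fin 9 → Fin 9} (hf : IsSteinerQuasigroup_s15 f)
    (hg : IsSteinerQuasigroup_s15 g) (hh : IsSteinerQuasigroup_s15 h) {x a b : Fin 9}
    (hxa : x ≠ a) (hxb : x ≠ b) (hab : a ≠ b) (hxab : x ≠ f a b)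
    (hfg : ∀ y, f x y = g x y) (hfh : ∀ y, f x y = h x y)
    (hgab : g a b = f a b) (hhab : h a b = f a b) : f = g ∨ f = h ∨ g = h := by
  obtain ⟨d, hd⟩ : ∃ d, d ∉ [x, a, b, f a b, f x a, f x b, f x (f a b)].toFinset := by
    by_contra! hall
    have h1 := Finset.card_le_card (fun d _ => hall d : (Finset.univ : Finset (Fin 9)) ⊆ _)
    have h2 := List.toFinset_card_le [x, a, b, f a b, f x a, f x b, f x (f a b)]
    simp only [Finset.card_univ, Fintype.card_fin, List.length_cons, List.length_nil] at h1 h2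
    omega
  have hnodup : [x, a, b, f a b, f x a, f x b, f x (f a b), d, f x d].Nodup := by
    obtain ⟨hi, hc, hk⟩ := hf
    simp only [List.mem_toFinset, List.mem_cons, List.not_mem_nil, or_false, not_or] at hd
    simp only [List.nodup_cons, List.mem_cons, List.not_mem_nil, or_false, not_or, List.nodup_nil]
    and_intros <;> grind
  have hinj : Function.Injective ![x, a, b, f a b, f x a, f x b, f x (f a b), d, f x d] := by
    rw [← List.nodup_ofFn]
    simpa [List.ofFn_succ] using hnodup
  let e : Fin 9 ≃ Fin 9 := Equiv.ofBijective _ (Finite.injective_iff_bijective.1 hinj)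
  have hstd : ∀ q : Fin 9 → Fin 9 → Fin 9, IsSteinerQuasigroup_s15 q → (∀ y, f x y = q x y) →
      q a b = f a b → IsStandard fun i j => e.symm (q (e i) (e j)) := by
    intro q hq hfq hqab
    refine ⟨hq.conj e, ?_, ?_, ?_, ?_, ?_⟩ <;> rw [Equiv.symm_apply_eq]
    · exact (hfq a).symm
    · exact (hfq b).symm
    · exact (hfq (f a b)).symm
    · exact (hfq d).symm
    · exact hqab
  have conj_inj : ∀ q r : Fin 9 → Fin 9 → Fin 9,
      (fun i j => e.symm (q (e i) (e j))) = (fun i j => e.symm (r (e i) (e j))) → q = r := by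
    intro q r hqr
    ext1 i
    ext1 j
    simpa using congrFun (congrFun hqr (e.symm i)) (e.symm j)
  have sf := hstd f hf (fun _ => rfl) rfl
  have sg := hstd g hg hfg hgab
  have sh := hstd h hh hfh hhab
  rcases sf.one_five with h1 | h1 <;> rcases sg.one_five with h2 | h2 <;>
    rcases sh.one_five with h3 | h3
  all_goals first
    | exact Or.inl (conj_inj _ _ (sf.eq sg (h1.trans h2.symm)))
    | exact Or.inr (Or.inl (conj_inj _ _ (sf.eq sh (h1.trans h3.symm))))
    | exact Or.inr (Or.inr (conj_inj _ _ (sg.eq sh (h2.trans h3.symm))))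

/-- A criterion for `IsSTS` that is cheap to evaluate. -/
theorem isSTS_of_card_filter {v : ℕ} {B : Finset (Finset (Fin v))} (h3 : ∀ b ∈ B, b.card = 3)
    (h : ∀ i j : Fin v, i < j → (B.filter fun b => i ∈ b ∧ j ∈ b).card = 1) : IsSTS v B := by
  refine ⟨h3, fun p hp => ?_⟩
  obtain ⟨i, j, hij, rfl⟩ : ∃ i j, i < j ∧ p = {i, j} := by
    obtain ⟨i, j, hne, rfl⟩ := Finset.card_eq_two.1 hp
    rcases lt_or_gt_of_ne hne with hlt | hlt
    · exact ⟨i, j, hlt, rfl⟩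
    · exact ⟨j, i, hlt, Finset.pair_comm i j⟩
  obtain ⟨b, hb⟩ := Finset.card_eq_one.1 (h i j hij)
  have hmem : ∀ c, (c ∈ B ∧ {i, j} ⊆ c) ↔ c = b := by
    intro c
    rw [← Finset.mem_singleton, ← hb, Finset.mem_filter, Finset.insert_subset_iff,
      Finset.singleton_subset_iff]
  exact ⟨b, (hmem b).2 rfl, fun c hc => (hmem c).1 hc⟩

/-- Three `STS(9)`s with a common flower at `0` and no other common triples. -/
def sunflowerSTS : Fin 3 → Finset (Finset (Fin 9)) := ![
  {{0, 1, 4}, {0, 2, 5}, {0, 3, 6}, {0, 7, 8}, {1, 2, 3}, {1, 5, 7}, {1, 6, 8}, {2, 4, 8},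
    {2, 6, 7}, {3, 4, 7}, {3, 5, 8}, {4, 5, 6}},
  {{0, 1, 4}, {0, 2, 5}, {0, 3, 6}, {0, 7, 8}, {1, 2, 6}, {1, 3, 7}, {1, 5, 8}, {2, 3, 8},
    {2, 4, 7}, {3, 4, 5}, {4, 6, 8}, {5, 6, 7}},
  {{0, 1, 4}, {0, 2, 5}, {0, 3, 6}, {0, 7, 8}, {1, 2, 7}, {1, 3, 8}, {1, 5, 6}, {2, 3, 4},
    {2, 6, 8}, {3, 5, 7}, {4, 5, 8}, {4, 6, 7}}]

theorem isSTS_sunflowerSTS (i : Fin 3) : IsSTS 9 (sunflowerSTS i) := by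
  apply isSTS_of_card_filter
  · fin_cases i <;> simp [sunflowerSTS]
  · revert i
    decide +kernel

/-- `J³_F(4) = {0, 8}`. -/
theorem stmt15 : J3F 4 = {0, 8} := by
  ext k
  simp only [Set.mem_insert_iff, Set.mem_singleton_iff]
  constructor
  · rintro ⟨B₁, B₂, B₃, x, h₁, h₂, h₃, h12, h13, hcard, hfl2, hfl3, hfl⟩
    by_cases hk : k = 0
    · exact Or.inl hk
    right
    obtain ⟨t, ht, htf⟩ := Finset.exists_mem_notMem_of_card_lt_card
      (show (flowerAt B₁ x).card < (B₁ ∩ B₂).card by omega)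
    have ht3 : t ∈ B₃ := (Finset.mem_inter.1 (h12 ▸ ht)).2
    obtain ⟨ht1, ht2⟩ := Finset.mem_inter.1 ht
    have hxt : x ∉ t := fun hx => htf (Finset.mem_filter.2 ⟨ht1, hx⟩)
    obtain ⟨a, b, c, hab, hac, hbc, rfl⟩ := Finset.card_eq_three.1 (h₁.1 t ht1)
    obtain ⟨f, hf, hfB⟩ := h₁.exists_quasigroup
    obtain ⟨g, hg, hgB⟩ := h₂.exists_quasigroup
    obtain ⟨h, hh, hhB⟩ := h₃.exists_quasigroup
    have hfab := (hfB a b c hab hac hbc).1 ht1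
    simp only [Finset.mem_insert, Finset.mem_singleton, not_or] at hxt
    have heq := exists_eq_of_common hf hg hh hxt.1 hxt.2.1 hab (hfab ▸ hxt.2.2)
      (eq_of_flowerAt_eq hf hg hfB hgB hfl2) (eq_of_flowerAt_eq hf hh hfB hhB hfl3)
      (((hgB a b c hab hac hbc).1 ht2).trans hfab.symm)
      (((hhB a b c hab hac hbc).1 ht3).trans hfab.symm)
    have hfull : B₁ ∩ B₂ = B₁ ∨ B₁ ∩ B₂ = B₂ := by
      rcases heq with rfl | rfl | rfl
      · left
        rw [h₁.eq_of_quasigroup_eq h₂ hfB hgB, Finset.inter_self]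
      · left
        rw [h12, h₁.eq_of_quasigroup_eq h₃ hfB hhB, Finset.inter_self]
      · right
        rw [h13, h₂.eq_of_quasigroup_eq h₃ hgB hhB, Finset.inter_self]
    have hc1 := h₁.three_mul_card
    have hc2 := h₂.three_mul_card
    have : (2 * 4 + 1).choose 2 = 36 := rfl
    rcases hfull with e | e <;> rw [e] at hcard <;> omega
  · rintro (rfl | rfl)
    · exact ⟨sunflowerSTS 0, sunflowerSTS 1, sunflowerSTS 2, 0, isSTS_sunflowerSTS 0,
        isSTS_sunflowerSTS 1, isSTS_sunflowerSTS 2, by decide +kernel, by decide +kernel,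
        by decide +kernel, by decide +kernel, by decide +kernel, by decide +kernel⟩
    · exact ⟨sunflowerSTS 0, sunflowerSTS 0, sunflowerSTS 0, 0, isSTS_sunflowerSTS 0,
        isSTS_sunflowerSTS 0, isSTS_sunflowerSTS 0, rfl, rfl,
        by decide +kernel, rfl, rfl, by decide +kernel⟩
end
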